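/- arXiv:1211.5642 — 2 statements merged into one kernel-verified Lean document; each statement's English description precedes it below -/
import Mathlib

section
/- Let A be a symmetric, essentially nonpositive tensor of order k and dimension n, and suppose λ is the least H-eigenvalue of A (λ is an H-eigenvalue and every H-eigenvalue μ of A satisfies λ ≤ μ). Then λ ≤ R̄(A), the average of the row sums of A, and λ ≤ d_min(A), the smallest diagonal entry of A. -/
open Finset

/-- `A x^k = ∑_{i₁,…,i_k} a_{i₁…i_k} x_{i₁}⋯x_{i_k}`. -/
def tApply (k n : ℕ) (A : (Fin k → Fin n) → ℝ) (x : Fin n → ℝ) : ℝ :=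
  ∑ f : Fin k → Fin n, A f * ∏ j : Fin k, x (f j)

/-- The `i`-th component of `A x^{k-1}`:
`∑_{i₂,…,i_k} a_{i i₂…i_k} x_{i₂}⋯x_{i_k}`. -/
def tApplyVec (k n : ℕ) (hk : 2 ≤ k) (A : (Fin k → Fin n) → ℝ) (x : Fin n → ℝ)
    (i : Fin n) : ℝ :=
  ∑ f ∈ Finset.univ.filter (fun f : Fin k → Fin n => f ⟨0, by omega⟩ = i),
    A f * ∏ j ∈ Finset.univ.erase (⟨0, by omega⟩ : Fin k), x (f j)

/-- A tensor is symmetric if its entries are invariant under permutations of the indices. -/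
def IsSymmTensor (k n : ℕ) (A : (Fin k → Fin n) → ℝ) : Prop :=
  ∀ (σ : Equiv.Perm (Fin k)) (f : Fin k → Fin n), A (f ∘ σ) = A f

/-- `lam` is an H-eigenvalue of `A`: there is a real `x ≠ 0` with `A x^{k-1} = lam x^{[k-1]}`. -/
def IsHEigenvalue (k n : ℕ) (hk : 2 ≤ k) (A : (Fin k → Fin n) → ℝ) (lam : ℝ) : Prop :=
  ∃ x : Fin n → ℝ, x ≠ 0 ∧ ∀ i : Fin n, tApplyVec k n hk A x i = lam * x i ^ (k - 1)

/-- The `i`-th row sum `R_i(A) = ∑_{i₂,…,i_k} a_{i i₂…i_k}`. -/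
def rowSum (k n : ℕ) (hk : 2 ≤ k) (A : (Fin k → Fin n) → ℝ) (i : Fin n) : ℝ :=
  ∑ f ∈ Finset.univ.filter (fun f : Fin k → Fin n => f ⟨0, by omega⟩ = i), A f

lemma aux_tApply_smul (k n : ℕ) (A : (Fin k → Fin n) → ℝ) (c : ℝ) (x : Fin n → ℝ) :
    tApply k n A (fun i => c * x i) = c ^ k * tApply k n A x := by
  unfold tApply
  rw [Finset.mul_sum]
  refine Finset.sum_congr rfl fun f _ => ?_
  rw [Finset.prod_mul_distrib]
  simp
  ring

/-- There is a nonnegative minimizer of the Rayleigh quotient. -/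
lemma aux_exists_min (k n : ℕ) (hk : 2 ≤ k) (hn : 1 ≤ n) (A : (Fin k → Fin n) → ℝ) :
    ∃ (mu : ℝ) (x : Fin n → ℝ), (∀ i, 0 ≤ x i) ∧ x ≠ 0 ∧
      tApply k n A x - mu * ∑ i, x i ^ k = 0 ∧
      ∀ y : Fin n → ℝ, (∀ i, 0 ≤ y i) → 0 ≤ tApply k n A y - mu * ∑ i, y i ^ k := by
  have hP : ∀ y : Fin n → ℝ, (∀ i, 0 ≤ y i) → y ≠ 0 → 0 < ∑ i, y i ^ k := by
    intro y hy h0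
    obtain ⟨i, hi⟩ := Function.ne_iff.mp h0
    have hi' : 0 < y i := lt_of_le_of_ne (hy i) (Ne.symm hi)
    exact Finset.sum_pos' (fun j _ => pow_nonneg (hy j) k) ⟨i, Finset.mem_univ _, pow_pos hi' k⟩
  have hS0 : ∀ y ∈ stdSimplex ℝ (Fin n), y ≠ 0 := by
    rintro y ⟨_, h1⟩ rfl
    simp at h1
  have hcF : Continuous (fun y : Fin n → ℝ => tApply k n A y) := by
    unfold tApply; fun_prop
  have hcP : Continuous (fun y : Fin n → ℝ => ∑ i, y i ^ k) := by fun_prop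
  have hne : (stdSimplex ℝ (Fin n)).Nonempty := 
    ⟨_, single_mem_stdSimplex ℝ (⟨0, by omega⟩ : Fin n)⟩
  obtain ⟨x, hx, hxmin⟩ := (isCompact_stdSimplex ℝ (Fin n)).exists_isMinOn hne
    (f := fun y => tApply k n A y / ∑ i, y i ^ k)
    (hcF.continuousOn.div hcP.continuousOn
      fun y hy => (hP y hy.1 (hS0 y hy)).ne')
  refine ⟨tApply k n A x / ∑ i, x i ^ k, x, hx.1, hS0 x hx, ?_, ?_⟩
  · rw [div_mul_cancel₀ _ (hP x hx.1 (hS0 x hx)).ne', sub_self]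
  · intro y hy
    by_cases h0 : y = 0
    · subst h0
      have : tApply k n A 0 = 0 := by
        unfold tApply
        refine Finset.sum_eq_zero fun f _ => ?_
        simp [show k ≠ 0 by omega]
      rw [this]
      simp [show k ≠ 0 by omega]
    · have hs : 0 < ∑ i, y i := by
        obtain ⟨i, hi⟩ := Function.ne_iff.mp h0
        exact Finset.sum_pos' (fun j _ => hy j)
          ⟨i, Finset.mem_univ _, lt_of_le_of_ne (hy i) (Ne.symm hi)⟩
      set s := ∑ i, y i with hsdef
      have hz : (fun i => s⁻¹ * y i) ∈ stdSimplex ℝ (Fin n) := by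
        refine ⟨fun i => mul_nonneg (inv_nonneg.mpr hs.le) (hy i), ?_⟩
        rw [← Finset.mul_sum, ← hsdef, inv_mul_cancel₀ hs.ne']
      have h := hxmin hz
      simp only [Set.mem_ofPred_eq] at h
      rw [aux_tApply_smul] at h
      simp only [mul_pow] at h
      rw [← Finset.mul_sum, mul_div_mul_left _ _ (pow_pos (inv_pos.mpr hs) k).ne',
        le_div_iff₀ (hP y hy h0)] at h
      linarith

lemma aux_swap_sum (k n : ℕ) (hk : 2 ≤ k) (A : (Fin k → Fin n) → ℝ) (hsym : IsSymmTensor k n A)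
    (x : Fin n → ℝ) (i : Fin n) (j : Fin k) :
    (∑ f : Fin k → Fin n, A f * ((∏ l ∈ Finset.univ.erase j, x (f l)) * if f j = i then 1 else 0))
      = tApplyVec k n hk A x i := by
  unfold tApplyVec
  set z : Fin k := ⟨0, by omega⟩ with hz
  rw [Finset.sum_filter]
  refine Fintype.sum_equiv (Equiv.arrowCongr (Equiv.swap z j) (Equiv.refl _)) _ _ fun f => ?_
  have e : (Equiv.arrowCongr (Equiv.swap z j) (Equiv.refl (Fin n))) f = f ∘ (Equiv.swap z j) := by
    ext l; simp [Equiv.arrowCongr]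
  rw [e, hsym]
  have hp : ∏ l ∈ Finset.univ.erase z, x ((f ∘ Equiv.swap z j) l)
      = ∏ l ∈ Finset.univ.erase j, x (f l) := by
    refine Finset.prod_equiv (Equiv.swap z j) ?_ ?_
    · intro l
      simp only [Finset.mem_erase, Finset.mem_univ, and_true]
      rw [not_iff_not, Equiv.swap_apply_eq_iff, Equiv.swap_apply_right]
    · intro l _; rfl
  rw [hp]
  simp only [Function.comp_apply, Equiv.swap_apply_left]
  split_ifs <;> simp

lemma aux_deriv (k n : ℕ) (hk : 2 ≤ k) (A : (Fin k → Fin n) → ℝ) (hsym : IsSymmTensor k n A)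
    (mu : ℝ) (x : Fin n → ℝ) (i : Fin n) :
    HasDerivAt (fun t : ℝ => tApply k n A (fun l => x l + t * if l = i then 1 else 0)
        - mu * ∑ l, (x l + t * if l = i then 1 else 0) ^ k)
      (k * (tApplyVec k n hk A x i - mu * x i ^ (k - 1))) 0 := by
  have hc : ∀ l : Fin n, HasDerivAt (fun t : ℝ => x l + t * if l = i then (1:ℝ) else 0)
      (if l = i then 1 else 0) 0 := by
    intro l
    simpa using ((hasDerivAt_id (0:ℝ)).mul_const (if l = i then (1:ℝ) else 0)).const_add (x l)
  have h1 : HasDerivAt (fun t : ℝ => tApply k n A (fun l => x l + t * if l = i then 1 else 0))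
      (∑ f : Fin k → Fin n, A f * ∑ j : Fin k,
        ((∏ l ∈ Finset.univ.erase j, x (f l)) * if f j = i then 1 else 0)) 0 := by
    unfold tApply
    refine HasDerivAt.fun_sum fun f _ => HasDerivAt.const_mul _ ?_
    have := HasDerivAt.fun_finsetProd (u := Finset.univ) (x := (0:ℝ))
      (f := fun (j : Fin k) (t : ℝ) => x (f j) + t * if f j = i then (1:ℝ) else 0)
      (f' := fun j => if f j = i then (1:ℝ) else 0) (fun j _ => hc (f j))
    simpa using this
  have h2 : HasDerivAt (fun t : ℝ => ∑ l, (x l + t * if l = i then 1 else 0) ^ k)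
      (k * x i ^ (k-1)) 0 := by
    have := HasDerivAt.fun_sum (u := Finset.univ) fun l _ => (hc l).fun_pow k
    simpa using this
  have h3 : (∑ f : Fin k → Fin n, A f * ∑ j : Fin k,
        ((∏ l ∈ Finset.univ.erase j, x (f l)) * if f j = i then 1 else 0))
      = k * tApplyVec k n hk A x i := by
    simp only [Finset.mul_sum (Finset.univ : Finset (Fin k))]
    rw [Finset.sum_comm, Finset.sum_congr rfl fun j _ => aux_swap_sum k n hk A hsym x i j]
    simp
  rw [h3] at h1
  exact (h1.fun_sub (h2.const_mul mu)).congr_deriv (by ring)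

lemma aux_eigen (k n : ℕ) (hk : 2 ≤ k) (A : (Fin k → Fin n) → ℝ) (hsym : IsSymmTensor k n A)
    (hess : ∀ f : Fin k → Fin n, (¬ ∃ i : Fin n, ∀ j : Fin k, f j = i) → A f ≤ 0)
    (mu : ℝ) (x : Fin n → ℝ) (hx : ∀ i, 0 ≤ x i)
    (h0 : tApply k n A x - mu * ∑ i, x i ^ k = 0)
    (hm : ∀ y : Fin n → ℝ, (∀ i, 0 ≤ y i) → 0 ≤ tApply k n A y - mu * ∑ i, y i ^ k)
    (i : Fin n) : tApplyVec k n hk A x i = mu * x i ^ (k - 1) := by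
  have hd := aux_deriv k n hk A hsym mu x i
  set G := fun t : ℝ => tApply k n A (fun l => x l + t * if l = i then 1 else 0)
        - mu * ∑ l, (x l + t * if l = i then 1 else 0) ^ k with hG
  have hG0 : G 0 = 0 := by simpa [hG] using h0
  have hGt : ∀ t, 0 ≤ x i + t → 0 ≤ G t := by
    intro t ht
    refine hm _ fun l => ?_
    by_cases hl : l = i
    · subst hl; simpa using ht
    · simpa [hl] using hx l
  have hkpos : (0:ℝ) < k := by exact_mod_cast (by omega : 0 < k)
  rcases (hx i).eq_or_lt with hxi | hxi
  · have hge : 0 ≤ (k:ℝ) * (tApplyVec k n hk A x i - mu * x i ^ (k - 1)) := by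
      have ht := hd.tendsto_slope_zero_right
      refine ge_of_tendsto ht ?_
      filter_upwards [self_mem_nhdsWithin] with t ht
      have ht' : (0:ℝ) < t := ht
      rw [zero_add, hG0, sub_zero, smul_eq_mul]
      exact mul_nonneg (inv_nonneg.mpr ht'.le) (hGt t (by linarith))
    have hz : x i ^ (k-1) = 0 := by rw [← hxi]; exact zero_pow (by omega)
    rw [hz] at hge ⊢
    have h1 : 0 ≤ tApplyVec k n hk A x i := by
      have := nonneg_of_mul_nonneg_right hge hkpos
      linarith
    have h2 : tApplyVec k n hk A x i ≤ 0 := by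
      unfold tApplyVec
      refine Finset.sum_nonpos fun f hf => ?_
      by_cases hdg : ∃ a : Fin n, ∀ j : Fin k, f j = a
      · obtain ⟨a, ha⟩ := hdg
        have hai : a = i := by
          rw [← (Finset.mem_filter.mp hf).2, ha]
        rw [Finset.prod_eq_zero (i := (⟨1, by omega⟩ : Fin k)) (by simp)
          (by rw [ha, hai, ← hxi]), mul_zero]
      · exact mul_nonpos_of_nonpos_of_nonneg (hess f hdg) (Finset.prod_nonneg fun j _ => hx _)
    linarith
  · have hloc : IsLocalMin G 0 := by
      have : ∀ᶠ t : ℝ in nhds 0, -x i < t := lt_mem_nhds (by linarith)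
      filter_upwards [this] with t ht
      rw [hG0]
      exact hGt t (by linarith)
    have h := hloc.hasDerivAt_eq_zero hd
    rcases mul_eq_zero.mp h with h | h
    · exact absurd h hkpos.ne'
    · linarith

/-- the least H-eigenvalue of a symmetric, essentially nonpositive
tensor is at most the average row sum and at most the smallest diagonal entry. -/
theorem min_heigenvalue_le_avg_rowSum_and_diag (k n : ℕ) (hk : 2 ≤ k) (hn : 1 ≤ n)
    (A : (Fin k → Fin n) → ℝ) (hsym : IsSymmTensor k n A)
    (hess : ∀ f : Fin k → Fin n, (¬ ∃ i : Fin n, ∀ j : Fin k, f j = i) → A f ≤ 0)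
    (lam : ℝ) (hlam : IsHEigenvalue k n hk A lam)
    (hmin : ∀ mu : ℝ, IsHEigenvalue k n hk A mu → lam ≤ mu) :
    lam ≤ (1 / (n : ℝ)) * ∑ i : Fin n, rowSum k n hk A i ∧
    lam ≤ Finset.univ.inf'
      (⟨(⟨0, by omega⟩ : Fin n), Finset.mem_univ _⟩ : (Finset.univ : Finset (Fin n)).Nonempty)
      (fun i : Fin n => A (fun _ => i)) := by
  obtain ⟨mu, x, hx, hx0, h0, hm⟩ := aux_exists_min k n hk hn A
  have hle : lam ≤ mu := hmin mu ⟨x, hx0, aux_eigen k n hk A hsym hess mu x hx h0 hm⟩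
  have hnpos : (0:ℝ) < n := by exact_mod_cast hn
  refine ⟨hle.trans ?_, hle.trans ?_⟩
  · have h := hm (fun _ => 1) (fun _ => zero_le_one)
    have hs : tApply k n A (fun _ => 1) = ∑ i : Fin n, rowSum k n hk A i := by
      unfold tApply rowSum
      rw [Finset.sum_fiberwise]
      simp
    rw [hs] at h
    simp only [one_pow, Finset.sum_const, Finset.card_univ, Fintype.card_fin, nsmul_eq_mul,
      mul_one] at h
    rw [one_div, inv_mul_eq_div, le_div_iff₀ hnpos]
    linarith
  · refine Finset.le_inf' _ _ fun i _ => ?_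
    have h := hm (fun l => if l = i then 1 else 0) (fun l => by split_ifs <;> norm_num)
    have hs : tApply k n A (fun l => if l = i then 1 else 0) = A (fun _ => i) := by
      unfold tApply
      rw [Finset.sum_eq_single (fun _ => i)]
      · simp
      · intro f _ hf
        obtain ⟨j, hj⟩ := Function.ne_iff.mp hf
        rw [Finset.prod_eq_zero (Finset.mem_univ j) (by simp [hj]), mul_zero]
      · simp
    rw [hs] at h
    have hp : ∑ l : Fin n, (if l = i then (1:ℝ) else 0) ^ k = 1 := by
      simp [ite_pow, show k ≠ 0 by omega]
    rw [hp] at h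
    linarith
end

section
/- Let B be a real symmetric tensor of order k and dimension n. Suppose that for each i = 1,…,n, the diagonal entry plus the sum of all negative off-diagonal entries in the i-th row is strictly positive, i.e., b_{i…i} + ∑_{(i₂,…,i_k) ≠ (i,…,i)} min(b_{i i₂…i_k}, 0) > 0. Then B is strictly copositive. -/
open Finset

/-- AM-GM for a product of `k` nonnegative reals. -/
lemma amgm_aux (k : ℕ) (hk : 2 ≤ k) (y : Fin k → ℝ) (hy : ∀ j, 0 ≤ y j) :
    (∏ j, y j) ≤ (k : ℝ)⁻¹ * ∑ j, y j ^ k := by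
  have hk0 : k ≠ 0 := by omega
  have hkR : (k : ℝ) ≠ 0 := by exact_mod_cast hk0
  have h := Real.geom_mean_le_arith_mean_weighted Finset.univ (fun _ : Fin k => (k : ℝ)⁻¹)
    (fun j => y j ^ k) (fun _ _ => by positivity) (by simp [hkR])
    (fun j _ => pow_nonneg (hy j) k)
  rw [Finset.mul_sum]
  refine le_trans (le_of_eq ?_) h
  exact Finset.prod_congr rfl fun j _ => (Real.pow_rpow_inv_natCast (hy j) hk0).symm

/-- a positive diagonal dominated symmetric tensor is strictly
copositive. -/
theorem strictly_copositive_of_diag_dominated (k n : ℕ) (hk : 2 ≤ k) (hn : 1 ≤ n)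
    (B : (Fin k → Fin n) → ℝ) (hsym : IsSymmTensor k n B)
    (hdom : ∀ i : Fin n,
      0 < B (fun _ => i) +
        ∑ f ∈ Finset.univ.filter
          (fun f : Fin k → Fin n => f ⟨0, by omega⟩ = i ∧ f ≠ (fun _ => i)),
          min (B f) 0) :
    ∀ x : Fin n → ℝ, (∀ i, 0 ≤ x i) → x ≠ 0 → 0 < tApply k n B x := by
  intro x hx hx0
  have hk0 : k ≠ 0 := by omega
  have hkR : (k : ℝ) ≠ 0 := by exact_mod_cast hk0
  let z : Fin k := ⟨0, by omega⟩
  classical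
  obtain ⟨C, hC⟩ : ∃ C : (Fin k → Fin n) → ℝ,
      ∀ f, C f = if (∃ i, f = fun _ => i) then B f else min (B f) 0 := ⟨_, fun _ => rfl⟩
  have hCsym : ∀ (σ : Equiv.Perm (Fin k)) (f : Fin k → Fin n), C (f ∘ σ) = C f := by
    intro σ f
    have hiff : (∃ i, f ∘ σ = fun _ => i) ↔ (∃ i, f = fun _ => i) := by
      constructor
      · rintro ⟨i, hi⟩
        refine ⟨i, funext fun j => ?_⟩
        have := congrFun hi (σ.symm j)
        simpa using this
      · rintro ⟨i, rfl⟩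
        exact ⟨i, rfl⟩
    rw [hC, hC, hsym σ f]
    simp only [hiff]
  have hrow : ∀ i, 0 < ∑ f ∈ Finset.univ.filter (fun f : Fin k → Fin n => f z = i), C f := by
    intro i
    have h := hdom i
    have hmem : (fun _ => i : Fin k → Fin n) ∈
        Finset.univ.filter (fun f : Fin k → Fin n => f z = i) := by simp
    rw [← Finset.add_sum_erase _ _ hmem]
    have h1 : C (fun _ => i) = B (fun _ => i) := by
      rw [hC, if_pos ⟨i, rfl⟩]
    have h2 : (Finset.univ.filter (fun f : Fin k → Fin n => f z = i)).erase (fun _ => i) =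
        Finset.univ.filter (fun f : Fin k → Fin n => f z = i ∧ f ≠ (fun _ => i)) := by
      ext f
      simp only [Finset.mem_erase, Finset.mem_filter, Finset.mem_univ, true_and]
      tauto
    rw [h1, h2]
    refine lt_of_lt_of_eq h ?_
    congr 1
    refine Finset.sum_congr rfl fun f hf => ?_
    simp only [Finset.mem_filter, Finset.mem_univ, true_and] at hf
    rw [hC, if_neg]
    rintro ⟨a, rfl⟩
    exact hf.2 (by rw [← hf.1])
  have hterm : ∀ f : Fin k → Fin n,
      C f * ((k : ℝ)⁻¹ * ∑ j, x (f j) ^ k) ≤ B f * ∏ j, x (f j) := by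
    intro f
    have hp : 0 ≤ ∏ j, x (f j) := Finset.prod_nonneg fun j _ => hx _
    rw [hC]
    split_ifs with hf
    · obtain ⟨i, rfl⟩ := hf
      simp [hkR]
    · calc _ ≤ min (B f) 0 * ∏ j, x (f j) :=
            mul_le_mul_of_nonpos_left (amgm_aux k hk (fun j => x (f j)) fun j => hx _)
              (min_le_right _ _)
        _ ≤ _ := mul_le_mul_of_nonneg_right (min_le_left _ _) hp
  have hswap : ∀ j : Fin k, ∑ f : Fin k → Fin n, C f * x (f j) ^ k =
      ∑ f : Fin k → Fin n, C f * x (f z) ^ k := by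
    intro j
    refine Fintype.sum_equiv ((Equiv.swap z j).arrowCongr (Equiv.refl (Fin n))) _ _ fun f => ?_
    have he : ((Equiv.swap z j).arrowCongr (Equiv.refl (Fin n))) f = f ∘ (Equiv.swap z j) := by
      ext a; simp [Equiv.arrowCongr]
    rw [he, hCsym]
    simp
  have hsum : ∑ f : Fin k → Fin n, C f * ((k : ℝ)⁻¹ * ∑ j, x (f j) ^ k) =
      ∑ f : Fin k → Fin n, C f * x (f z) ^ k := by
    have h1 : ∑ f : Fin k → Fin n, C f * ((k : ℝ)⁻¹ * ∑ j, x (f j) ^ k) =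
        (k : ℝ)⁻¹ * ∑ j : Fin k, ∑ f : Fin k → Fin n, C f * x (f j) ^ k := by
      rw [Finset.sum_comm, Finset.mul_sum]
      refine Finset.sum_congr rfl fun f _ => ?_
      rw [← Finset.mul_sum]; ring
    rw [h1, Finset.sum_congr rfl fun j _ => hswap j]
    simp [hkR]
  have hfib : ∑ f : Fin k → Fin n, C f * x (f z) ^ k =
      ∑ i, (∑ f ∈ Finset.univ.filter (fun f : Fin k → Fin n => f z = i), C f) * x i ^ k := by
    rw [← Finset.sum_fiberwise Finset.univ (fun f : Fin k → Fin n => f z)]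
    refine Finset.sum_congr rfl fun i _ => ?_
    rw [Finset.sum_mul]
    refine Finset.sum_congr rfl fun f hf => ?_
    rw [(Finset.mem_filter.mp hf).2]
  obtain ⟨i, hi⟩ := Function.ne_iff.mp hx0
  have hpos : 0 < x i := lt_of_le_of_ne (hx i) (Ne.symm hi)
  calc 0 < ∑ i, (∑ f ∈ Finset.univ.filter (fun f : Fin k → Fin n => f z = i), C f) * x i ^ k :=
        Finset.sum_pos' (fun i _ => mul_nonneg (hrow i).le (pow_nonneg (hx i) k))
          ⟨i, Finset.mem_univ _, mul_pos (hrow i) (pow_pos hpos k)⟩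
    _ = ∑ f : Fin k → Fin n, C f * ((k : ℝ)⁻¹ * ∑ j, x (f j) ^ k) := by rw [hsum, hfib]
    _ ≤ tApply k n B x := Finset.sum_le_sum fun f _ => hterm f
end
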